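/- Let μ₁ and μ₂ be probability measures on ℝ₊^p with finite first moments, and let P(μ) denote the Poissonization of μ, i.e., the law of h(Λ) = (M₁(Λ₁),…,M_p(Λ_p)) where Λ has law μ and M₁,…,M_p are mutually independent unit-rate Poisson processes independent of Λ. Then for every coupling γ of μ₁ and μ₂, W(P(μ₁), P(μ₂)) ≤ √p · E_{(Λ,Λ̃)∼γ}[‖Λ − Λ̃‖₂]; consequently W(P(μ₁), P(μ₂)) ≤ √p · inf over couplings γ of μ₁ and μ₂ of E_{(Λ,Λ̃)∼γ}[‖Λ − Λ̃‖₂]. -/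

import Mathlib

open MeasureTheory ProbabilityTheory

noncomputable section

/-- Interpret a plain vector in `Fin p → ℝ` as an element of Euclidean space
(so that `‖·‖` is the Euclidean norm). -/
noncomputable def toE {p : ℕ} (f : Fin p → ℝ) : EuclideanSpace ℝ (Fin p) :=
  (WithLp.equiv 2 (Fin p → ℝ)).symm f

/-- The Poissonization `P(ν)` of a measure `ν` on `ℝ₊^p`: the law of
`(M₁(Λ₁),…,M_p(Λ_p))` where `Λ ∼ ν` and the `Mᵢ` are mutually independent unit-rate
Poisson processes independent of `Λ`; i.e. the mixture over `λ ∼ ν` of products of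
Poisson distributions with means `λᵢ`, viewed as a measure on `ℝ^p`. -/
noncomputable def poissonize (p : ℕ) (ν : Measure (EuclideanSpace ℝ (Fin p))) :
    Measure (EuclideanSpace ℝ (Fin p)) :=
  ν.bind (fun lam =>
    Measure.map (fun k : Fin p → ℕ => toE (fun i => (k i : ℝ)))
      (Measure.pi (fun i => poissonMeasure (Real.toNNReal (lam i)))))

/-- The Wasserstein-1 distance between two measures on `EuclideanSpace ℝ (Fin p)`,
defined by Kantorovich–Rubinstein duality as the supremum over `1`-Lipschitz test
functions (with respect to the Euclidean norm) of the difference of integrals. -/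
noncomputable def W1 {p : ℕ} (μ ν : Measure (EuclideanSpace ℝ (Fin p))) : ℝ :=
  ⨆ f : {f : EuclideanSpace ℝ (Fin p) → ℝ // LipschitzWith 1 f},
    (∫ x, (f : EuclideanSpace ℝ (Fin p) → ℝ) x ∂μ -
      ∫ x, (f : EuclideanSpace ℝ (Fin p) → ℝ) x ∂ν)

open scoped NNReal Nat

theorem hasSum_poisson_mean (r : ℝ≥0) :
    HasSum (fun n : ℕ => Real.exp (-r) * r ^ n / n ! * (n : ℝ)) r := by
  rw [← hasSum_nat_add_iff' 1]
  have h : (fun n : ℕ => Real.exp (-r) * r ^ (n + 1) / (n + 1)! * ((n + 1 : ℕ) : ℝ)) =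
      fun n : ℕ => (r : ℝ) * (Real.exp (-r) * r ^ n / n !) := by
    funext n
    rw [Nat.factorial_succ]
    push_cast
    field_simp
    ring
  rw [h]
  simpa using (hasSum_one_poissonMeasure r).mul_left (r : ℝ)

theorem integrable_natCast_poissonMeasure (r : ℝ≥0) :
    Integrable (fun n : ℕ => (n : ℝ)) (poissonMeasure r) := by
  rw [integrable_poissonMeasure_iff]
  simpa using (hasSum_poisson_mean r).summable

theorem integral_natCast_poissonMeasure (r : ℝ≥0) :
    ∫ n : ℕ, (n : ℝ) ∂(poissonMeasure r) = r := by
  rw [integral_poissonMeasure]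
  simpa using (hasSum_poisson_mean r).tsum_eq

/-- The law of a vector of independent Poisson variables with means `a i`. -/
def poissonPi {p : ℕ} (a : Fin p → ℝ≥0) : Measure (Fin p → ℕ) :=
  Measure.pi fun i => poissonMeasure (a i)

section PoissonPi

variable {p : ℕ}

instance (a : Fin p → ℝ≥0) : IsProbabilityMeasure (poissonPi a) := by
  unfold poissonPi; infer_instance

theorem poissonPi_add (a b : Fin p → ℝ≥0) :
    poissonPi (a + b) = ((poissonPi a).prod (poissonPi b)).map (fun z => z.1 + z.2) := by
  have h := (measurePreserving_arrowProdEquivProdArrow ℕ ℕ (Fin p)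
    (fun i => poissonMeasure (a i)) (fun i => poissonMeasure (b i))).map_eq
  unfold poissonPi
  rw [← h, Measure.map_map (by fun_prop) (by fun_prop)]
  have hconv (i : Fin p) : ((poissonMeasure (a i)).prod (poissonMeasure (b i))).map
      (fun z => z.1 + z.2) = poissonMeasure (a i + b i) :=
    poissonMeasure_conv_poissonMeasure (a i) (b i)
  have hsf (i : Fin p) : SigmaFinite (((poissonMeasure (a i)).prod (poissonMeasure (b i))).map
      (fun z : ℕ × ℕ => z.1 + z.2)) := by
    rw [hconv]; infer_instance
  have h2 := Measure.pi_map_pi (μ := fun i => (poissonMeasure (a i)).prod (poissonMeasure (b i)))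
    (f := fun _ (z : ℕ × ℕ) => z.1 + z.2) (fun i => by fun_prop)
  simp_rw [hconv] at h2
  exact h2.symm

theorem measurable_poissonPi : Measurable (poissonPi (p := p)) := by
  refine Measure.measurable_of_measurable_coe _ fun s hs => ?_
  have h (a : Fin p → ℝ≥0) : poissonPi a s = ∑' k, s.indicator (fun k => ∏ i,
      ENNReal.ofReal (Real.exp (-a i) * a i ^ k i / (k i)!)) k := by
    rw [← Measure.tsum_indicator_apply_singleton _ s hs]
    simp_rw [poissonPi, Measure.pi_singleton, poissonMeasure_singleton]
  simp_rw [h]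
  refine Measurable.tsum fun k => ?_
  by_cases hk : k ∈ s
  · simp only [hk, Set.indicator_of_mem]
    fun_prop
  · simp [hk]

theorem integrable_sum_natCast_poissonPi (a : Fin p → ℝ≥0) :
    Integrable (fun k : Fin p → ℕ => ∑ i, (k i : ℝ)) (poissonPi a) :=
  integrable_finsetSum _ fun i _ =>
    integrable_comp_eval (μ := fun i => poissonMeasure (a i))
      (integrable_natCast_poissonMeasure (a i))

theorem integral_sum_natCast_poissonPi (a : Fin p → ℝ≥0) :
    ∫ k : Fin p → ℕ, ∑ i, (k i : ℝ) ∂(poissonPi a) = ∑ i, (a i : ℝ) := by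
  rw [integral_finsetSum]
  · refine Finset.sum_congr rfl fun i _ => ?_
    rw [← integral_natCast_poissonMeasure (a i)]
    exact integral_comp_eval (μ := fun i => poissonMeasure (a i))
      (f := fun n : ℕ => (n : ℝ)) (by fun_prop)
  · exact fun i _ => integrable_comp_eval (μ := fun i => poissonMeasure (a i))
      (integrable_natCast_poissonMeasure (a i))

theorem norm_toE_natCast_le (k : Fin p → ℕ) :
    ‖toE fun i => (k i : ℝ)‖ ≤ ∑ i, (k i : ℝ) := by
  rw [EuclideanSpace.norm_eq, Real.sqrt_le_left (by positivity)]
  simpa [toE] using Finset.sum_sq_le_sq_sum_of_nonneg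
    (s := Finset.univ) (f := fun i => (k i : ℝ)) (fun i _ => by positivity)

theorem LipschitzWith.abs_comp_toE_add_sub_le {f : EuclideanSpace ℝ (Fin p) → ℝ}
    (hf : LipschitzWith 1 f) (k l : Fin p → ℕ) :
    |f (toE fun i => ((k + l) i : ℝ)) - f (toE fun i => (k i : ℝ))| ≤ ∑ i, (l i : ℝ) := by
  have h := hf.dist_le_mul (toE fun i => ((k + l) i : ℝ)) (toE fun i => (k i : ℝ))
  rw [Real.dist_eq, dist_eq_norm, NNReal.coe_one, one_mul] at h
  refine (h.trans_eq ?_).trans (norm_toE_natCast_le l)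
  congr 1
  ext i
  simp [toE]

theorem LipschitzWith.integrable_poissonPi {f : EuclideanSpace ℝ (Fin p) → ℝ}
    (hf : LipschitzWith 1 f) (a : Fin p → ℝ≥0) :
    Integrable (fun k : Fin p → ℕ => f (toE fun i => (k i : ℝ))) (poissonPi a) := by
  refine ((integrable_const |f (toE fun _ => 0)|).add
    (integrable_sum_natCast_poissonPi a)).mono' .of_discrete (ae_of_all _ fun k => ?_)
  have h := hf.abs_comp_toE_add_sub_le 0 k
  simp only [zero_add, Pi.zero_apply, Nat.cast_zero] at h
  simp only [Real.norm_eq_abs, Pi.add_apply]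
  linarith [abs_sub_abs_le_abs_sub (f (toE fun i => (k i : ℝ))) (f (toE fun _ => 0))]

theorem LipschitzWith.abs_integral_poissonPi_add_sub_le {f : EuclideanSpace ℝ (Fin p) → ℝ}
    (hf : LipschitzWith 1 f) (a b : Fin p → ℝ≥0) :
    |∫ k, f (toE fun i => (k i : ℝ)) ∂(poissonPi (a + b)) -
      ∫ k, f (toE fun i => (k i : ℝ)) ∂(poissonPi a)| ≤ ∑ i, (b i : ℝ) := by
  have hadd : Integrable (fun z : (Fin p → ℕ) × (Fin p → ℕ) =>
      f (toE fun i => ((z.1 + z.2) i : ℝ))) ((poissonPi a).prod (poissonPi b)) := by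
    have h := hf.integrable_poissonPi (a + b)
    rw [poissonPi_add] at h
    exact h.comp_measurable (by fun_prop)
  have hfst : Integrable (fun z : (Fin p → ℕ) × (Fin p → ℕ) =>
      f (toE fun i => (z.1 i : ℝ))) ((poissonPi a).prod (poissonPi b)) :=
    (hf.integrable_poissonPi a).comp_fst _
  have hfst_eq : ∫ k, f (toE fun i => (k i : ℝ)) ∂(poissonPi a) =
      ∫ z, f (toE fun i => (z.1 i : ℝ)) ∂((poissonPi a).prod (poissonPi b)) := by
    rw [integral_fun_fst (fun k : Fin p → ℕ => f (toE fun i => (k i : ℝ)))]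
    simp
  rw [poissonPi_add, integral_map (by fun_prop) .of_discrete, hfst_eq, ← integral_sub hadd hfst,
    ← integral_sum_natCast_poissonPi b]
  calc _ ≤ ∫ z, ∑ i, (z.2 i : ℝ) ∂((poissonPi a).prod (poissonPi b)) := by
        rw [← Real.norm_eq_abs]
        exact norm_integral_le_of_norm_le ((integrable_sum_natCast_poissonPi b).comp_snd _)
          (ae_of_all _ fun z => hf.abs_comp_toE_add_sub_le z.1 z.2)
    _ = _ := by
        rw [integral_fun_snd (fun k : Fin p → ℕ => ∑ i, (k i : ℝ))]
        simp

theorem LipschitzWith.abs_integral_poissonPi_sub_le {f : EuclideanSpace ℝ (Fin p) → ℝ}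
    (hf : LipschitzWith 1 f) (a b : Fin p → ℝ≥0) :
    |∫ k, f (toE fun i => (k i : ℝ)) ∂(poissonPi a) -
      ∫ k, f (toE fun i => (k i : ℝ)) ∂(poissonPi b)| ≤ ∑ i, |(a i : ℝ) - b i| := by
  have inf_add_tsub (a b : Fin p → ℝ≥0) : a ⊓ b + (a - b) = a := by
    funext i
    simp [add_comm (min (a i) (b i)), tsub_add_min]
  have ha := inf_add_tsub a b
  have hb := inf_add_tsub b a
  rw [inf_comm] at hb
  have h1 := hf.abs_integral_poissonPi_add_sub_le (a ⊓ b) (a - b)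
  have h2 := hf.abs_integral_poissonPi_add_sub_le (a ⊓ b) (b - a)
  rw [ha] at h1
  rw [hb, abs_sub_comm] at h2
  have hsum : ∑ i, |(a i : ℝ) - b i| =
      ∑ i, (((a - b) i : ℝ≥0) : ℝ) + ∑ i, (((b - a) i : ℝ≥0) : ℝ) := by
    rw [← Finset.sum_add_distrib]
    refine Finset.sum_congr rfl fun i _ => ?_
    rcases le_total (a i) (b i) with h | h
    · simp [tsub_eq_zero_of_le h, NNReal.coe_sub h, abs_of_nonpos, h]
    · simp [tsub_eq_zero_of_le h, NNReal.coe_sub h, abs_of_nonneg, h]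
  rw [hsum]
  exact (abs_sub_le _ _ _).trans (add_le_add h1 h2)

theorem sum_abs_toNNReal_sub_le (x y : EuclideanSpace ℝ (Fin p)) :
    ∑ i, |((x i).toNNReal : ℝ) - (y i).toNNReal| ≤ √p * ‖x - y‖ := by
  have h : ∑ i, |((x i).toNNReal : ℝ) - (y i).toNNReal| ≤ ∑ i, |x i - y i| := by
    refine Finset.sum_le_sum fun i _ => ?_
    simpa using abs_max_sub_max_le_abs (x i) (y i) 0
  refine h.trans ?_
  rw [EuclideanSpace.norm_eq, ← Real.sqrt_mul (by positivity)]
  refine Real.le_sqrt_of_sq_le ?_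
  simpa using sq_sum_le_card_mul_sum_sq (s := Finset.univ) (f := fun i => |x i - y i|)

/-- The Markov kernel sending `x` to the law of a vector of independent Poisson variables
with means `x i`. -/
def poissonPiKernel (p : ℕ) : Kernel (EuclideanSpace ℝ (Fin p)) (EuclideanSpace ℝ (Fin p)) where
  toFun x := (poissonPi fun i => (x i).toNNReal).map fun k => toE fun i => (k i : ℝ)
  measurable' :=
    (Measure.measurable_map _ .of_discrete).comp (measurable_poissonPi.comp (by fun_prop))

instance : IsMarkovKernel (poissonPiKernel p) :=
  ⟨fun _ => Measure.isProbabilityMeasure_map .of_discrete⟩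

theorem poissonize_eq_bind_poissonPiKernel (ν : Measure (EuclideanSpace ℝ (Fin p))) :
    poissonize p ν = ν.bind (poissonPiKernel p) := rfl

theorem LipschitzWith.integrable_poissonPiKernel {f : EuclideanSpace ℝ (Fin p) → ℝ}
    (hf : LipschitzWith 1 f) (x : EuclideanSpace ℝ (Fin p)) :
    Integrable f (poissonPiKernel p x) :=
  (integrable_map_measure hf.continuous.aestronglyMeasurable .of_discrete).2
    (hf.integrable_poissonPi _)

theorem LipschitzWith.abs_integral_poissonPiKernel_sub_le {f : EuclideanSpace ℝ (Fin p) → ℝ}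
    (hf : LipschitzWith 1 f) (x y : EuclideanSpace ℝ (Fin p)) :
    |∫ z, f z ∂(poissonPiKernel p x) - ∫ z, f z ∂(poissonPiKernel p y)| ≤ √p * ‖x - y‖ := by
  have h (x : EuclideanSpace ℝ (Fin p)) : ∫ z, f z ∂(poissonPiKernel p x) =
      ∫ k, f (toE fun i => (k i : ℝ)) ∂(poissonPi fun i => (x i).toNNReal) :=
    integral_map .of_discrete hf.continuous.aestronglyMeasurable
  rw [h, h]
  exact (hf.abs_integral_poissonPi_sub_le _ _).trans (sum_abs_toNNReal_sub_le x y)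

theorem LipschitzWith.integrable_integral_poissonPiKernel {f : EuclideanSpace ℝ (Fin p) → ℝ}
    (hf : LipschitzWith 1 f) {ν : Measure (EuclideanSpace ℝ (Fin p))} [IsFiniteMeasure ν]
    (hν : Integrable (fun x => ‖x‖) ν) :
    Integrable (fun x => ∫ z, f z ∂(poissonPiKernel p x)) ν := by
  have hmeas : StronglyMeasurable (fun x => ∫ z, f z ∂(poissonPiKernel p x)) :=
    hf.continuous.stronglyMeasurable.integral_kernel
  refine ((integrable_const |∫ z, f z ∂(poissonPiKernel p 0)|).add (hν.const_mul √p)).mono'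
    hmeas.aestronglyMeasurable (ae_of_all _ fun x => ?_)
  have h := hf.abs_integral_poissonPiKernel_sub_le x 0
  rw [sub_zero] at h
  simp only [Real.norm_eq_abs, Pi.add_apply]
  linarith [abs_sub_abs_le_abs_sub (∫ z, f z ∂(poissonPiKernel p x))
    (∫ z, f z ∂(poissonPiKernel p 0))]

theorem LipschitzWith.integral_poissonize {f : EuclideanSpace ℝ (Fin p) → ℝ}
    (hf : LipschitzWith 1 f) {ν : Measure (EuclideanSpace ℝ (Fin p))} [IsFiniteMeasure ν]
    (hν : Integrable (fun x => ‖x‖) ν) :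
    ∫ z, f z ∂(poissonize p ν) = ∫ x, ∫ z, f z ∂(poissonPiKernel p x) ∂ν := by
  have hnorm : LipschitzWith 1 fun z => ‖f z‖ := by
    simpa only [one_mul, Function.comp_def] using lipschitzWith_one_norm.comp hf
  rw [poissonize_eq_bind_poissonPiKernel, Measure.comp_eq_comp_const_apply,
    Kernel.integral_comp, Kernel.const_apply]
  rw [← Measure.comp_eq_comp_const_apply,
    Measure.integrable_comp_iff hf.continuous.aestronglyMeasurable]
  exact ⟨ae_of_all _ hf.integrable_poissonPiKernel,
    hnorm.integrable_integral_poissonPiKernel hν⟩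

theorem W1_poissonize_le_of_coupling {μ₁ μ₂ : Measure (EuclideanSpace ℝ (Fin p))}
    (hμ₁ : Integrable (fun x => ‖x‖) μ₁) (hμ₂ : Integrable (fun x => ‖x‖) μ₂)
    (γ : Measure (EuclideanSpace ℝ (Fin p) × EuclideanSpace ℝ (Fin p))) [IsFiniteMeasure γ]
    (h₁ : γ.map Prod.fst = μ₁) (h₂ : γ.map Prod.snd = μ₂) :
    W1 (poissonize p μ₁) (poissonize p μ₂) ≤ √p * ∫ z, ‖z.1 - z.2‖ ∂γ := by
  subst h₁ h₂
  have hfst : Integrable (fun z => z.1) γ :=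
    (integrable_norm_iff (by fun_prop)).1 (hμ₁.comp_measurable measurable_fst)
  have hsnd : Integrable (fun z => z.2) γ :=
    (integrable_norm_iff (by fun_prop)).1 (hμ₂.comp_measurable measurable_snd)
  have : Nonempty {f : EuclideanSpace ℝ (Fin p) → ℝ // LipschitzWith 1 f} :=
    ⟨⟨fun _ => 0, LipschitzWith.const' 0⟩⟩
  refine ciSup_le fun f => ?_
  obtain ⟨f, hf : LipschitzWith 1 f⟩ := f
  simp only
  have hi₁ := hf.integrable_integral_poissonPiKernel hμ₁
  have hi₂ := hf.integrable_integral_poissonPiKernel hμ₂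
  have hi₁γ : Integrable (fun z => ∫ y, f y ∂(poissonPiKernel p z.1)) γ :=
    hi₁.comp_measurable measurable_fst
  have hi₂γ : Integrable (fun z => ∫ y, f y ∂(poissonPiKernel p z.2)) γ :=
    hi₂.comp_measurable measurable_snd
  rw [hf.integral_poissonize hμ₁, hf.integral_poissonize hμ₂,
    integral_map (by fun_prop) hi₁.1, integral_map (by fun_prop) hi₂.1,
    ← integral_sub hi₁γ hi₂γ, ← integral_const_mul]
  exact integral_mono (hi₁γ.sub hi₂γ) ((hfst.sub hsnd).norm.const_mul _)
    fun z => (le_abs_self _).trans (hf.abs_integral_poissonPiKernel_sub_le z.1 z.2)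

end PoissonPi

/-- For probability measures `μ₁, μ₂` on `ℝ₊^p` with finite first moments,
every coupling `γ` of `μ₁` and `μ₂` satisfies
`W(P(μ₁), P(μ₂)) ≤ √p · E_{(Λ,Λ̃)∼γ}[‖Λ − Λ̃‖₂]`, and consequently
`W(P(μ₁), P(μ₂)) ≤ √p · inf_γ E_{(Λ,Λ̃)∼γ}[‖Λ − Λ̃‖₂]`. -/
theorem poissonize_wasserstein_bound {p : ℕ}
    (μ₁ μ₂ : Measure (EuclideanSpace ℝ (Fin p)))
    [IsProbabilityMeasure μ₁] [IsProbabilityMeasure μ₂]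
    (hμ₁m : Integrable (fun x => ‖x‖) μ₁) (hμ₂m : Integrable (fun x => ‖x‖) μ₂)
    (hμ₁pos : ∀ᵐ x ∂μ₁, ∀ i, 0 ≤ x i) (hμ₂pos : ∀ᵐ x ∂μ₂, ∀ i, 0 ≤ x i) :
    (∀ γ : Measure (EuclideanSpace ℝ (Fin p) × EuclideanSpace ℝ (Fin p)),
      IsProbabilityMeasure γ → γ.map Prod.fst = μ₁ → γ.map Prod.snd = μ₂ →
        W1 (poissonize p μ₁) (poissonize p μ₂) ≤ Real.sqrt p * ∫ z, ‖z.1 - z.2‖ ∂γ) ∧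
    W1 (poissonize p μ₁) (poissonize p μ₂) ≤
      Real.sqrt p *
        ⨅ γ : {γ : Measure (EuclideanSpace ℝ (Fin p) × EuclideanSpace ℝ (Fin p)) //
            IsProbabilityMeasure γ ∧ γ.map Prod.fst = μ₁ ∧ γ.map Prod.snd = μ₂},
          ∫ z : EuclideanSpace ℝ (Fin p) × EuclideanSpace ℝ (Fin p), ‖z.1 - z.2‖ ∂(γ.1) := by
  have hcoup : ∀ γ : Measure (EuclideanSpace ℝ (Fin p) × EuclideanSpace ℝ (Fin p)),
      IsProbabilityMeasure γ → γ.map Prod.fst = μ₁ → γ.map Prod.snd = μ₂ →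
        W1 (poissonize p μ₁) (poissonize p μ₂) ≤ √p * ∫ z, ‖z.1 - z.2‖ ∂γ :=
    fun γ _ h₁ h₂ => W1_poissonize_le_of_coupling hμ₁m hμ₂m γ h₁ h₂
  refine ⟨hcoup, ?_⟩
  have : Nonempty {γ : Measure (EuclideanSpace ℝ (Fin p) × EuclideanSpace ℝ (Fin p)) //
      IsProbabilityMeasure γ ∧ γ.map Prod.fst = μ₁ ∧ γ.map Prod.snd = μ₂} :=
    ⟨⟨μ₁.prod μ₂, inferInstance, by simp [Measure.map_fst_prod], by simp [Measure.map_snd_prod]⟩⟩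
  rw [Real.mul_iInf_of_nonneg (Real.sqrt_nonneg _)]
  exact le_ciInf fun γ => hcoup γ.1 γ.2.1 γ.2.2.1 γ.2.2.2

end
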